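/- arXiv:2310.11526 — 6 statements merged into one kernel-verified Lean document; each statement's English description precedes it below -/
import Mathlib

section
/- For every real d with 0 ≤ d < 1, letting H(d) := −((1+d)/2)·log₂((1+d)/2) − ((1−d)/2)·log₂((1−d)/2) (with 0·log₂ 0 = 0), one has the identity 1 − H(d) = (d²/(2·ln 2)) · ∑_{m=1}^{∞} d^{2m−2} / (m·(2m−1)). -/
theorem hasSum_one_add_mul_log_add_one_sub_mul_log {d : ℝ} (hd : |d| < 1) :
    HasSum (fun m : ℕ => d ^ 2 * (d ^ (2 * m) / (((m : ℝ) + 1) * (2 * (m : ℝ) + 1))))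
      ((1 + d) * Real.log (1 + d) + (1 - d) * Real.log (1 - d)) := by
  obtain ⟨hneg, hpos⟩ := abs_lt.mp hd
  have hsq : |d ^ 2| < 1 := by
    rw [abs_pow]
    exact pow_lt_one₀ (abs_nonneg d) hd two_ne_zero
  have hlog : Real.log (1 - d ^ 2) = Real.log (1 + d) + Real.log (1 - d) := by
    rw [← Real.log_mul (by linarith) (by linarith)]
    congr 1
    ring
  have hterm (m : ℕ) : d ^ 2 * (d ^ (2 * m) / (((m : ℝ) + 1) * (2 * (m : ℝ) + 1))) =
      d * (2 * (1 / (2 * (m : ℝ) + 1)) * d ^ (2 * m + 1)) - (d ^ 2) ^ (m + 1) / ((m : ℝ) + 1) := by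
    have h1 : (m : ℝ) + 1 ≠ 0 := by positivity
    have h2 : 2 * (m : ℝ) + 1 ≠ 0 := by positivity
    field_simp
    ring
  have hvalue : (1 + d) * Real.log (1 + d) + (1 - d) * Real.log (1 - d) =
      d * (Real.log (1 + d) - Real.log (1 - d)) - -Real.log (1 - d ^ 2) := by
    rw [hlog]
    ring
  simp only [hterm, hvalue]
  exact ((Real.hasSum_log_sub_log_of_abs_lt_one hd).mul_left d).sub
    (Real.hasSum_pow_div_log_of_abs_lt_one hsq)

theorem stmt2 (d : ℝ) (hd0 : 0 ≤ d) (hd1 : d < 1) :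
    1 - (-(((1 + d) / 2) * Real.logb 2 ((1 + d) / 2))
          - ((1 - d) / 2) * Real.logb 2 ((1 - d) / 2))
      = (d ^ 2 / (2 * Real.log 2)) *
          ∑' m : ℕ, d ^ (2 * m) / (((m : ℝ) + 1) * (2 * (m : ℝ) + 1)) := by
  have hsum := (hasSum_one_add_mul_log_add_one_sub_mul_log
    (abs_lt.mpr ⟨by linarith, hd1⟩)).tsum_eq
  rw [tsum_mul_left] at hsum
  have hlog2 : Real.log 2 ≠ 0 := (Real.log_pos one_lt_two).ne'
  rw [div_mul_eq_mul_div (d ^ 2), hsum, Real.logb, Real.logb, Real.log_div (by linarith) two_ne_zero,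
    Real.log_div (by linarith) two_ne_zero]
  field_simp
  ring
end

section
/- Let n ≥ 1 and let X be a distribution on {0,1}^n with H_min(X) ≥ k for some real k > 0. Let D be the distribution of the pair (r, ⟨x,r⟩) where r ← U_n and x ← X are sampled independently, and let D' be the distribution of (r, u) where r ← U_n and u is a uniform bit sampled independently. Then SD(D, D') ≤ 2^{(1−k)/2}. -/
/-- `P` is a probability distribution on the finite set `S`. -/
def IsDist {S : Type*} [Fintype S] (P : S → ℝ) : Prop :=
  (∀ x, 0 ≤ P x) ∧ (∑ x, P x) = 1

/-- Boolean inner product of two length-`n` bit strings. -/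
def ip {n : ℕ} (x r : Fin n → ZMod 2) : ZMod 2 := ∑ i, x i * r i

/-- The min-entropy `H_min(P) = -log₂ max_x P x` of a distribution on a finite set. -/
noncomputable def Hmin {S : Type*} [Fintype S] [Nonempty S] (P : S → ℝ) : ℝ :=
  -Real.logb 2 (Finset.univ.sup' Finset.univ_nonempty P)

/-- The nontrivial real character of `ZMod 2`. -/
noncomputable def bitSign (z : ZMod 2) : ℝ := if z = 0 then 1 else -1

lemma bitSign_zero : bitSign 0 = 1 := by simp [bitSign]

lemma bitSign_one : bitSign 1 = -1 := by simp [bitSign]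

lemma ZMod.two_cases (a : ZMod 2) : a = 0 ∨ a = 1 := by
  revert a
  decide

lemma bitSign_add (a b : ZMod 2) : bitSign (a + b) = bitSign a * bitSign b := by
  have h : (1 : ZMod 2) + 1 = 0 := by decide
  rcases ZMod.two_cases a with rfl | rfl <;> rcases ZMod.two_cases b with rfl | rfl <;>
    simp [h, bitSign_zero, bitSign_one]

lemma bitSign_sum {ι : Type*} (s : Finset ι) (f : ι → ZMod 2) :
    bitSign (∑ i ∈ s, f i) = ∏ i ∈ s, bitSign (f i) := by
  classical
  induction s using Finset.induction_on with
  | empty => simp [bitSign_zero]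
  | insert a s ha ih => rw [Finset.sum_insert ha, Finset.prod_insert ha, bitSign_add, ih]

lemma ite_eq_bitSign (a b : ZMod 2) (c : ℝ) :
    (if a = b then c else 0) = (c + bitSign b * (c * bitSign a)) / 2 := by
  rcases ZMod.two_cases a with rfl | rfl <;> rcases ZMod.two_cases b with rfl | rfl <;>
    simp [bitSign_zero, bitSign_one]

lemma abs_bitSign (b : ZMod 2) : |bitSign b| = 1 := by
  rcases ZMod.two_cases b with rfl | rfl <;> simp [bitSign_zero, bitSign_one]

lemma sum_bitSign_mul (a b : ZMod 2) :
    ∑ t : ZMod 2, bitSign (a * t) * bitSign (b * t) = if a = b then 2 else 0 := by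
  have h (f : ZMod 2 → ℝ) : ∑ t, f t = f 0 + f 1 := Fin.sum_univ_two f
  rw [h]
  rcases ZMod.two_cases a with rfl | rfl <;> rcases ZMod.two_cases b with rfl | rfl <;>
    simp [bitSign_zero, bitSign_one] <;> norm_num

/-- Orthogonality of the characters of `{0,1}^n`. -/
lemma sum_bitSign_ip {n : ℕ} (x y : Fin n → ZMod 2) :
    ∑ r, bitSign (ip x r) * bitSign (ip y r) = if x = y then 2 ^ n else 0 := by
  simp only [ip, bitSign_sum, ← Finset.prod_mul_distrib]
  rw [← Fintype.prod_sum (fun i t => bitSign (x i * t) * bitSign (y i * t))]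
  simp only [sum_bitSign_mul]
  split_ifs with h
  · simp [h]
  · obtain ⟨i, hi⟩ := Function.ne_iff.mp h
    exact Finset.prod_eq_zero (Finset.mem_univ i) (if_neg hi)

/-- Parseval's identity on `{0,1}^n`. -/
lemma sum_sq_sum_mul_bitSign_ip {n : ℕ} (X : (Fin n → ZMod 2) → ℝ) :
    ∑ r, (∑ x, X x * bitSign (ip x r)) ^ 2 = 2 ^ n * ∑ x, X x ^ 2 := by
  have h (r : Fin n → ZMod 2) : (∑ x, X x * bitSign (ip x r)) ^ 2 =
      ∑ x, ∑ y, X x * X y * (bitSign (ip x r) * bitSign (ip y r)) := by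
    rw [sq, Finset.sum_mul_sum]
    refine Finset.sum_congr rfl fun x _ => Finset.sum_congr rfl fun y _ => ?_
    ring
  simp only [h]
  rw [Finset.sum_comm, Finset.mul_sum]
  refine Finset.sum_congr rfl fun x _ => ?_
  rw [Finset.sum_comm]
  simp only [← Finset.mul_sum, sum_bitSign_ip]
  simp only [mul_ite, mul_zero, Finset.sum_ite_eq, Finset.mem_univ, if_true]
  ring

lemma IsDist.le_rpow_neg_of_le_Hmin {S : Type*} [Fintype S] [Nonempty S] {P : S → ℝ}
    (hP : IsDist P) {k : ℝ} (hk : k ≤ Hmin P) (x : S) : P x ≤ (2 : ℝ) ^ (-k) := by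
  set M := Finset.univ.sup' Finset.univ_nonempty P with hM
  have hle (y : S) : P y ≤ M := Finset.le_sup' P (Finset.mem_univ y)
  have hpos : 0 < M := by
    by_contra! hM0
    have : ∑ y, P y ≤ 0 := Finset.sum_nonpos fun y _ => (hle y).trans hM0
    linarith [hP.2]
  refine (hle x).trans ((Real.logb_le_iff_le_rpow (by norm_num) hpos).mp ?_)
  have : k ≤ -Real.logb 2 M := hk
  linarith

lemma IsDist.sum_sq_le {S : Type*} [Fintype S] {P : S → ℝ} (hP : IsDist P) {c : ℝ}
    (hc : ∀ x, P x ≤ c) : ∑ x, P x ^ 2 ≤ c := by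
  calc ∑ x, P x ^ 2 ≤ ∑ x, c * P x :=
        Finset.sum_le_sum fun x _ => by
          rw [sq]
          exact mul_le_mul_of_nonneg_right (hc x) (hP.1 x)
    _ = c := by rw [← Finset.mul_sum, hP.2, mul_one]

/-- Inner product with a uniform seed is a good extractor (leftover hash lemma form):
if `H_min(X) ≥ k` then the distribution of `(r, ⟨x,r⟩)` (for independent `r ← U_n`, `x ← X`)
is within statistical distance `2^((1-k)/2)` of `(r, u)` with `u` a uniform independent bit. -/
theorem stmt3 (n : ℕ) (hn : 1 ≤ n) (X : (Fin n → ZMod 2) → ℝ) (hX : IsDist X)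
    (k : ℝ) (hk : 0 < k) (hmin : k ≤ Hmin X) :
    (1 / 2) * ∑ p : (Fin n → ZMod 2) × ZMod 2,
        |(1 / 2 ^ n) * (∑ x, if ip x p.1 = p.2 then X x else 0) - 1 / 2 ^ (n + 1)|
      ≤ (2 : ℝ) ^ ((1 - k) / 2) := by
  set F : (Fin n → ZMod 2) → ℝ := fun r => ∑ x, X x * bitSign (ip x r) with hF
  have hterm (r : Fin n → ZMod 2) (b : ZMod 2) :
      |(1 / 2 ^ n) * (∑ x, if ip x r = b then X x else 0) - 1 / 2 ^ (n + 1)|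
        = 1 / 2 ^ (n + 1) * |F r| := by
    have hsum : (∑ x, if ip x r = b then X x else 0) = (1 + bitSign b * F r) / 2 := by
      simp only [ite_eq_bitSign, hF]
      rw [← Finset.sum_div, Finset.sum_add_distrib, ← Finset.mul_sum, hX.2]
    have heq : (1 / 2 ^ n) * ((1 + bitSign b * F r) / 2) - 1 / 2 ^ (n + 1)
        = 1 / 2 ^ (n + 1) * (bitSign b * F r) := by
      rw [pow_succ]
      field_simp
      ring
    rw [hsum, heq, abs_mul, abs_mul, abs_bitSign, one_mul, abs_of_pos (by positivity)]
  have hSD : (1 / 2) * ∑ p : (Fin n → ZMod 2) × ZMod 2,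
        |(1 / 2 ^ n) * (∑ x, if ip x p.1 = p.2 then X x else 0) - 1 / 2 ^ (n + 1)|
      = 1 / 2 ^ (n + 1) * ∑ r, |F r| := by
    simp only [Fintype.sum_prod_type, hterm, Finset.sum_const, Finset.card_univ, ZMod.card,
      nsmul_eq_mul, ← Finset.mul_sum]
    push_cast
    ring
  have hsq : (∑ r, |F r|) ^ 2 ≤ (2 ^ n) ^ 2 * (2 : ℝ) ^ (-k) := by
    have hCS := sq_sum_le_card_mul_sum_sq (s := Finset.univ) (f := fun r => |F r|)
    have hcard : ((Finset.univ : Finset (Fin n → ZMod 2)).card : ℝ) = 2 ^ n := by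
      simp [Finset.card_univ, ZMod.card]
    simp only [sq_abs] at hCS
    rw [hcard, sum_sq_sum_mul_bitSign_ip X, ← mul_assoc, ← sq] at hCS
    exact hCS.trans (mul_le_mul_of_nonneg_left
      (hX.sum_sq_le (hX.le_rpow_neg_of_le_Hmin hmin)) (by positivity))
  rw [hSD]
  refine (pow_le_pow_iff_left₀ (by positivity) (by positivity) two_ne_zero).mp ?_
  have hR : ((2 : ℝ) ^ ((1 - k) / 2)) ^ 2 = 2 * (2 : ℝ) ^ (-k) := by
    rw [← Real.rpow_natCast, ← Real.rpow_mul (by norm_num),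
      show (1 - k) / 2 * ((2 : ℕ) : ℝ) = 1 + -k by push_cast; ring,
      Real.rpow_add (by norm_num), Real.rpow_one]
  have hpos : (0 : ℝ) < 2 ^ (-k) := by positivity
  calc (1 / 2 ^ (n + 1) * ∑ r, |F r|) ^ 2 =
        (1 / 2 ^ (n + 1)) ^ 2 * (∑ r, |F r|) ^ 2 := mul_pow _ _ _
    _ ≤ (1 / 2 ^ (n + 1)) ^ 2 * ((2 ^ n) ^ 2 * (2 : ℝ) ^ (-k)) := by gcongr
    _ = 1 / 4 * (2 : ℝ) ^ (-k) := by
      field_simp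
      ring
    _ ≤ ((2 : ℝ) ^ ((1 - k) / 2)) ^ 2 := by
      rw [hR]
      linarith
end

section
/- There exists N such that for all n ≥ N the following holds. Let X be a distribution on {0,1}^n and x* ∈ {0,1}^n with X(x*) > 1 − 1/n. For each fixed r ∈ {0,1}^n, let β₀(r) be the distribution of the single bit ⟨x,r⟩ for x ← X, and let β₁(r) be the distribution of the single bit that is uniform (independent of everything else) when x = x* and equals ⟨x,r⟩ otherwise, for x ← X. Then for every r ∈ {0,1}^n, H(β₁(r)) − H(β₀(r)) ≥ 1/(100 n²). -/
/-- The base-2 Shannon entropy of a distribution `P` on a finite set,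
with the convention `0 * log₂ 0 = 0` (note `Real.logb 2 0 = 0`). -/
noncomputable def shannonH {S : Type*} [Fintype S] (P : S → ℝ) : ℝ :=
  ∑ x, -(P x * Real.logb 2 (P x))

theorem ZMod.sum_two_eq_add (f : ZMod 2 → ℝ) (c : ZMod 2) : ∑ b, f b = f c + f (c + 1) := by
  have h : ∑ b, f b = f 0 + f 1 := Fin.sum_univ_two f
  have h2 : (1 + 1 : ZMod 2) = 0 := by decide
  obtain rfl | rfl : c = 0 ∨ c = 1 := by revert c; decide
  · rw [h, zero_add]
  · rw [h, h2, add_comm]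

theorem shannonH_zmod_two (P : ZMod 2 → ℝ) (c : ZMod 2) :
    shannonH P = (Real.negMulLog (P c) + Real.negMulLog (P (c + 1))) / Real.log 2 := by
  rw [shannonH, ZMod.sum_two_eq_add _ c]
  simp only [Real.negMulLog, Real.logb]
  ring

theorem mul_one_sub_le_negMulLog {q : ℝ} (hq : 0 ≤ q) : q * (1 - q) ≤ Real.negMulLog q := by
  obtain rfl | hq := hq.eq_or_lt
  · simp
  have h := mul_le_mul_of_nonneg_left (Real.log_le_sub_one_of_pos hq) hq.le
  rw [Real.negMulLog]
  linarith

theorem negMulLog_le_one_sub {q : ℝ} (hq : 0 < q) : Real.negMulLog q ≤ 1 - q := by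
  have h := mul_le_mul_of_nonneg_left (Real.one_sub_inv_le_log_of_pos hq) hq.le
  rw [mul_sub, mul_inv_cancel₀ hq.ne'] at h
  rw [Real.negMulLog]
  linarith

theorem negMulLog_sq_le {s : ℝ} (hs : 0 ≤ s) : Real.negMulLog (s ^ 2) ≤ 2 * s := by
  obtain rfl | hs := hs.eq_or_lt
  · simp
  have h := mul_le_mul_of_nonneg_left (negMulLog_le_one_sub hs) hs.le
  simp only [Real.negMulLog, Real.log_pow] at *
  push_cast
  nlinarith

/-- Spreading a point mass `p` close to `1` evenly over both values of a bit increases the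
entropy by a definite amount. -/
theorem negMulLog_gap {p a b : ℝ} (hp : 99 / 100 ≤ p) (ha : 0 ≤ a) (hb : 0 ≤ b)
    (hsum : p + a + b = 1) :
    Real.negMulLog (p + a) + Real.negMulLog b + 1 / 100 ≤
      Real.negMulLog (p / 2 + a) + Real.negMulLog (p / 2 + b) := by
  have h₁ := mul_one_sub_le_negMulLog (q := p / 2 + a) (by linarith)
  have h₂ := mul_one_sub_le_negMulLog (q := p / 2 + b) (by linarith)
  have h₃ := negMulLog_le_one_sub (q := p + a) (by linarith)
  have h₄ := negMulLog_sq_le (Real.sqrt_nonneg b)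
  rw [Real.sq_sqrt hb] at h₄
  have h₅ : √b ≤ 1 / 10 := Real.sqrt_le_iff.2 ⟨by norm_num, by linarith⟩
  nlinarith

theorem sum_ip_eq_add {n : ℕ} (X : (Fin n → ZMod 2) → ℝ) (xs r : Fin n → ZMod 2) (b : ZMod 2) :
    (∑ x, if ip x r = b then X x else 0) =
      (if ip xs r = b then X xs else 0) + ∑ x, if x ≠ xs ∧ ip x r = b then X x else 0 := by
  rw [← Finset.add_sum_erase _ _ (Finset.mem_univ xs),
    ← Finset.add_sum_erase (f := fun x => if x ≠ xs ∧ ip x r = b then X x else 0) _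
      (Finset.mem_univ xs)]
  simp only [ne_eq, not_true_eq_false, false_and, if_false, zero_add]
  congr 1
  refine Finset.sum_congr rfl fun x hx => ?_
  simp [Finset.ne_of_mem_erase hx]

/- `β₀(r)` is the distribution of the bit `⟨x,r⟩` for `x ← X`; `β₁(r)` is the distribution
of the bit that is uniform (independent) when `x = x*` and equals `⟨x,r⟩` otherwise. -/
theorem stmt5 :
    ∃ N : ℕ, ∀ n : ℕ, N ≤ n →
      ∀ X : (Fin n → ZMod 2) → ℝ, IsDist X →
      ∀ xs : Fin n → ZMod 2, 1 - 1 / (n : ℝ) < X xs →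
      ∀ r : Fin n → ZMod 2,
        shannonH (fun b : ZMod 2 => X xs / 2 + ∑ x, if x ≠ xs ∧ ip x r = b then X x else 0)
          - shannonH (fun b : ZMod 2 => ∑ x, if ip x r = b then X x else 0)
          ≥ 1 / (100 * (n : ℝ) ^ 2) := by
  refine ⟨100, fun n hn X hX xs hxs r => ?_⟩
  have hn' : (100 : ℝ) ≤ n := by exact_mod_cast hn
  have hp : 99 / 100 ≤ X xs := by
    have : 1 / (n : ℝ) ≤ 1 / 100 := one_div_le_one_div_of_le (by norm_num) hn'
    linarith
  have hpos (b : ZMod 2) : 0 ≤ ∑ x, if x ≠ xs ∧ ip x r = b then X x else 0 :=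
    Finset.sum_nonneg fun x _ => by split_ifs; exacts [hX.1 x, le_rfl]
  have hne : ip xs r ≠ ip xs r + 1 := by simp
  have hsum : ∑ b, (∑ x, if ip x r = b then X x else 0) = 1 := by
    rw [Finset.sum_comm]
    simpa using hX.2
  rw [ZMod.sum_two_eq_add _ (ip xs r)] at hsum
  rw [shannonH_zmod_two _ (ip xs r), shannonH_zmod_two _ (ip xs r)]
  simp only [sum_ip_eq_add X xs r, if_true, if_neg hne, zero_add] at hsum ⊢
  have hgap := negMulLog_gap hp (hpos _) (hpos _) hsum
  have hlog : 0 < Real.log 2 := Real.log_pos one_lt_two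
  have hlog' : Real.log 2 ≤ 1 := by linarith [Real.log_two_lt_d9]
  have hle : 1 / (100 * (n : ℝ) ^ 2) ≤ 1 / 100 :=
    one_div_le_one_div_of_le (by norm_num) (by nlinarith)
  rw [ge_iff_le, ← sub_div, le_div_iff₀ hlog]
  have : 1 / (100 * (n : ℝ) ^ 2) * Real.log 2 ≤ 1 / (100 * (n : ℝ) ^ 2) :=
    mul_le_of_le_one_right (by positivity) hlog'
  linarith
end

section
/- There exists N such that for all n ≥ N the following holds. Let {h_σ : {0,1}^n → {0,1}^{3n}}_{σ∈Σ} be a pairwise independent family with finite seed set Σ. Let K be a distribution on {0,1}^n and j an integer with 0 ≤ j ≤ 2n − 1 such that the set G := {k : 2^{−(j+1)} ≤ K(k) ≤ 2^{−j}} satisfies K(G) ≥ 1/(3n). Set i := j + ⌈600·log₂ n⌉ and A := {k : K(k) ≥ 2^{−j}·n^{−500}}, and assume i ≤ 3n. Then there exists a set F ⊆ Σ × {0,1}^i such that: (1) Pr_{σ ← Σ, k ← K}[ (σ, h_σ(k)_i) ∈ F ] ≥ 1/(6n) − 1/n^100; and (2) for every (σ, y) ∈ F, one has Pr_{k ← K}[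 h_σ(k)_i = y ] > 0, Pr_{k ← K}[ k ∈ G | h_σ(k)_i = y ] ≥ 1/(6n), and there is at most one k ∈ A with h_σ(k)_i = y. -/
open Finset in
/-- If a pair of points is hashed uniformly, then their length-`i` prefixes collide with
probability at most `2^{-i}`. -/
theorem card_prefix_collision_le {Sg X : Type*} [Fintype Sg] [Nonempty Sg] {m i : ℕ} (hi : i ≤ m)
    (h : Sg → X → (Fin m → ZMod 2)) (x y : X)
    (hxy : ∀ a b : Fin m → ZMod 2,
      ((univ.filter fun σ : Sg => h σ x = a ∧ h σ y = b).card : ℝ) / (Fintype.card Sg : ℝ)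
        = 1 / 2 ^ (2 * m)) :
    ((univ.filter fun σ : Sg => (fun t : Fin i => h σ x (Fin.castLE hi t))
        = fun t : Fin i => h σ y (Fin.castLE hi t)).card : ℝ)
      ≤ Fintype.card Sg * (1 / 2 ^ i) := by
  classical
  set S := univ.filter fun σ : Sg => (fun t : Fin i => h σ x (Fin.castLE hi t))
        = fun t : Fin i => h σ y (Fin.castLE hi t) with hS
  set P := univ.filter fun ab : (Fin m → ZMod 2) × (Fin m → ZMod 2) =>
    (fun t : Fin i => ab.1 (Fin.castLE hi t)) = fun t : Fin i => ab.2 (Fin.castLE hi t) with hP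
  have hc : (0 : ℝ) < Fintype.card Sg := by exact_mod_cast Fintype.card_pos
  have hPcard : P.card ≤ 2 ^ m * 2 ^ (m - i) := by
    have h1 : P.card ≤ (univ : Finset ((Fin m → ZMod 2) × (Fin (m - i) → ZMod 2))).card := by
      refine card_le_card_of_injOn
        (fun ab => (ab.1, fun t => ab.2 ⟨i + t, by omega⟩)) (fun _ _ => by simp) ?_
      rintro ⟨a, b⟩ hab ⟨a', b'⟩ hab' heq
      simp only [hP, coe_filter, mem_univ, true_and, Set.mem_ofPred_eq] at hab hab'
      simp only [Prod.mk.injEq] at heq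
      obtain ⟨rfl, hb⟩ := heq
      refine Prod.ext rfl (funext fun t => ?_)
      by_cases ht : (t : ℕ) < i
      · exact (congrFun hab ⟨t, ht⟩).symm.trans (congrFun hab' ⟨t, ht⟩)
      · have := congrFun hb ⟨t - i, by omega⟩
        have he : (⟨i + (t - i), by omega⟩ : Fin m) = t := Fin.ext (by simp; omega)
        simpa [he] using this
    simpa [ZMod.card] using h1
  have hsum : (S.card : ℝ) = ∑ ab ∈ P,
      ((univ.filter fun σ : Sg => h σ x = ab.1 ∧ h σ y = ab.2).card : ℝ) := by
    rw [card_eq_sum_card_fiberwise (f := fun σ => (h σ x, h σ y)) (t := P)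
      (fun σ hσ => by simpa [hS, hP] using hσ)]
    push_cast
    refine sum_congr rfl fun ab hab => ?_
    congr 2
    ext σ
    simp only [hS, mem_filter, mem_univ, true_and, Prod.ext_iff]
    refine ⟨fun h => h.2, fun h => ⟨?_, h⟩⟩
    rw [h.1, h.2]
    simpa [hP] using hab
  have hval : ∀ ab : (Fin m → ZMod 2) × (Fin m → ZMod 2),
      ((univ.filter fun σ : Sg => h σ x = ab.1 ∧ h σ y = ab.2).card : ℝ)
        = Fintype.card Sg * (1 / 2 ^ (2 * m)) := fun ab => by
    rw [← hxy ab.1 ab.2]; field_simp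
  rw [hsum, sum_congr rfl fun ab _ => hval ab, sum_const, nsmul_eq_mul, mul_left_comm]
  refine mul_le_mul_of_nonneg_left ?_ hc.le
  have hPc : (P.card : ℝ) ≤ 2 ^ m * 2 ^ (m - i) := by exact_mod_cast hPcard
  have h2 : (2 : ℝ) ^ m = 2 ^ (m - i) * 2 ^ i := by rw [← pow_add]; congr 1; omega
  rw [mul_one_div, div_le_div_iff₀ (by positivity) (by positivity)]
  calc (P.card : ℝ) * 2 ^ i ≤ 2 ^ m * 2 ^ (m - i) * 2 ^ i := by gcongr
    _ = 1 * 2 ^ (2 * m) := by rw [two_mul, pow_add, mul_assoc, ← h2, one_mul]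

/-- The part of `G` lying in cells where `G` has conditional probability less than `c` has
probability at most `c`. -/
theorem sum_sparse_cells_le {X Y : Type*} [Fintype X] [Fintype Y] [DecidableEq Y]
    (p : X → Y) {K : X → ℝ} (hK : IsDist K) (G : X → Prop) [DecidablePred G]
    (B : Y → Prop) [DecidablePred B] {c : ℝ} (hc : 0 ≤ c)
    (hB : ∀ y, B y → (∑ x, if G x ∧ p x = y then K x else 0)
      ≤ c * ∑ x, if p x = y then K x else 0) :
    (∑ x, if G x ∧ B (p x) then K x else 0) ≤ c := by
  have hfib : ∀ f : X → ℝ, ∑ x, f x = ∑ y, ∑ x, if p x = y then f x else 0 := fun f => by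
    rw [Finset.sum_comm]; simp
  calc (∑ x, if G x ∧ B (p x) then K x else 0)
      = ∑ y, ∑ x, if p x = y then (if G x ∧ B (p x) then K x else 0) else 0 := hfib _
    _ ≤ ∑ y, c * ∑ x, if p x = y then K x else 0 := by
        refine Finset.sum_le_sum fun y _ => ?_
        by_cases hy : B y
        · refine le_trans (le_of_eq (Finset.sum_congr rfl fun x _ => ?_)) (hB y hy)
          by_cases hx : p x = y <;> simp [hx, hy]
        · refine le_trans (le_of_eq (Finset.sum_eq_zero fun x _ => ?_))
            (mul_nonneg hc (Finset.sum_nonneg fun x _ => ?_))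
          · by_cases hx : p x = y <;> simp [hx, hy]
          · split_ifs
            exacts [hK.1 x, le_rfl]
    _ = c := by rw [← Finset.mul_sum, ← hfib, hK.2, mul_one]

/-- A distribution has at most `1 / τ` points of mass at least `τ`. -/
theorem IsDist.card_filter_le_mul {X : Type*} [Fintype X] {K : X → ℝ} (hK : IsDist K) (τ : ℝ)
    (A : X → Prop) [DecidablePred A] (hA : ∀ x, A x → τ ≤ K x) :
    ((Finset.univ.filter A).card : ℝ) * τ ≤ 1 := by
  rw [← hK.2, ← nsmul_eq_mul]
  exact (Finset.card_nsmul_le_sum _ K τ fun x hx => hA x (by simpa using hx)).trans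
    (Finset.sum_le_sum_of_subset_of_nonneg (Finset.subset_univ _) fun x _ _ => hK.1 x)

open Finset in
/-- If pairs of points collide under a random map `p σ` with probability at most `q`, then, except
for a probability at most `c + #A * q`, a point of `G` lands in a cell which contains at most
one point of `A` and in which `G` has conditional probability at least `c`. -/
theorem exists_isolating_cells {Sg X Y : Type*} [Fintype Sg] [Nonempty Sg] [DecidableEq Sg]
    [Fintype X] [Fintype Y] [DecidableEq Y] (p : Sg → X → Y) {q : ℝ}
    (hq : ∀ x y, x ≠ y →
      ((univ.filter fun σ => p σ x = p σ y).card : ℝ) ≤ Fintype.card Sg * q)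
    {K : X → ℝ} (hK : IsDist K) (G A : X → Prop) [DecidablePred G] [DecidablePred A]
    {c δ : ℝ} (hc : 0 ≤ c)
    (hδ : ((univ.filter A).card : ℝ) * q ≤ δ) (hδ0 : 0 ≤ δ) :
    ∃ F : Finset (Sg × Y),
      ((∑ x, if G x then K x else 0) - c - δ ≤
        ∑ σ, ∑ x, if (σ, p σ x) ∈ F then (1 / (Fintype.card Sg : ℝ)) * K x else 0) ∧
      ∀ σ y, (σ, y) ∈ F →
        (0 < ∑ x, if p σ x = y then K x else 0) ∧
        (c ≤ (∑ x, if G x ∧ p σ x = y then K x else 0) / ∑ x, if p σ x = y then K x else 0) ∧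
        ∀ x x', A x → p σ x = y → A x' → p σ x' = y → x = x' := by
  classical
  have hs : (0 : ℝ) < Fintype.card Sg := by exact_mod_cast Fintype.card_pos
  let D : Sg → Y → Prop := fun σ y => (0 < ∑ x, if p σ x = y then K x else 0) ∧
    (c ≤ (∑ x, if G x ∧ p σ x = y then K x else 0) / ∑ x, if p σ x = y then K x else 0)
  let I : Sg → Y → Prop := fun σ y => ∀ x x', A x → p σ x = y → A x' → p σ x' = y → x = x'
  refine ⟨univ.filter fun z => D z.1 z.2 ∧ I z.1 z.2, ?_, fun σ y hF => ?_⟩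
  swap
  · simp only [mem_filter, mem_univ, true_and] at hF
    exact ⟨hF.1.1, hF.1.2, hF.2⟩
  have hsparse : ∀ σ, (∑ x, if G x ∧ ¬ D σ (p σ x) then K x else 0) ≤ c := fun σ => by
    refine sum_sparse_cells_le (p σ) hK G (fun y => ¬ D σ y) hc fun y hy => ?_
    have hle : (∑ x, if G x ∧ p σ x = y then K x else 0) ≤ ∑ x, if p σ x = y then K x else 0 := by
      refine sum_le_sum fun x _ => ?_
      have := hK.1 x
      by_cases hx : G x <;> by_cases hy : p σ x = y <;> simp [hx, hy, this]
    by_cases hM : 0 < ∑ x, if p σ x = y then K x else 0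
    · have : ¬ c ≤ _ := fun hcy => hy ⟨hM, hcy⟩
      rw [not_le, div_lt_iff₀ hM] at this
      exact this.le
    · have h0 : (∑ x, if p σ x = y then K x else 0) = 0 := by
        refine le_antisymm (not_lt.1 hM) (sum_nonneg fun x _ => ?_)
        split_ifs
        exacts [hK.1 x, le_rfl]
      rw [h0] at hle ⊢
      simpa using hle
  have hcoll : ∀ x, ∑ σ, (if ∃ x', x' ≠ x ∧ A x' ∧ p σ x' = p σ x then (1 : ℝ) else 0)
      ≤ Fintype.card Sg * δ := fun x => by
    calc ∑ σ, (if ∃ x', x' ≠ x ∧ A x' ∧ p σ x' = p σ x then (1 : ℝ) else 0)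
        ≤ ∑ σ, ∑ x' ∈ (univ.filter A).erase x, if p σ x' = p σ x then (1 : ℝ) else 0 := by
          refine sum_le_sum fun σ _ => ?_
          have h0 : ∀ x' ∈ (univ.filter A).erase x,
              (0 : ℝ) ≤ if p σ x' = p σ x then (1 : ℝ) else 0 := fun x' _ => by positivity
          split_ifs with hx
          · obtain ⟨x', hne, hA, he⟩ := hx
            have := single_le_sum h0 (a := x') (by simp [hne, hA])
            simpa [he] using this
          · exact sum_nonneg h0
      _ = ∑ x' ∈ (univ.filter A).erase x, ((univ.filter fun σ => p σ x' = p σ x).card : ℝ) := by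
          rw [sum_comm]; simp
      _ ≤ ∑ x' ∈ (univ.filter A).erase x, (Fintype.card Sg * q : ℝ) :=
          sum_le_sum fun x' hx' => hq x' x (ne_of_mem_erase hx')
      _ = Fintype.card Sg * ((((univ.filter A).erase x).card : ℝ) * q) := by
          rw [sum_const, nsmul_eq_mul]; ring
      _ ≤ Fintype.card Sg * δ := by
          refine mul_le_mul_of_nonneg_left ?_ hs.le
          rcases le_total 0 q with hq0 | hq0
          · refine le_trans (mul_le_mul_of_nonneg_right ?_ hq0) hδ
            exact_mod_cast card_le_card (erase_subset _ _)
          · exact (mul_nonpos_of_nonneg_of_nonpos (Nat.cast_nonneg _) hq0).trans hδ0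
  have hpoint : ∀ σ x, (if G x then K x else 0) ≤
      (if (σ, p σ x) ∈ univ.filter (fun z : Sg × Y => D z.1 z.2 ∧ I z.1 z.2) then K x else 0)
      + (if G x ∧ ¬ D σ (p σ x) then K x else 0)
      + K x * (if ∃ x', x' ≠ x ∧ A x' ∧ p σ x' = p σ x then (1 : ℝ) else 0) := fun σ x => by
    have hKx := hK.1 x
    simp only [mem_filter, mem_univ, true_and]
    by_cases hG : G x
    · by_cases hD : D σ (p σ x)
      · by_cases hI : I σ (p σ x)
        · simp only [hG, hD, hI]
          simp only [if_true, and_self, not_true, and_false, if_false, add_zero]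
          exact le_add_of_nonneg_right (mul_nonneg hKx (by positivity))
        · have : ∃ x', x' ≠ x ∧ A x' ∧ p σ x' = p σ x := by
            by_contra! hno
            refine hI fun u v hu hpu hv hpv => ?_
            have key : ∀ w, A w → p σ w = p σ x → w = x := fun w hw hpw => by
              by_contra hne
              exact hno w hne hw hpw
            rw [key u hu hpu, key v hv hpv]
          rw [if_pos this]
          simp [hG, hD, hI]
      · simp only [hG, hD]
        simp only [if_true, false_and, not_false_eq_true, and_self, if_false, zero_add]
        exact le_add_of_nonneg_right (mul_nonneg hKx (by positivity))
    · simp only [hG, if_false, false_and, add_zero]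
      exact add_nonneg (by positivity) (mul_nonneg hKx (by positivity))
  have htot := sum_le_sum fun σ (_ : σ ∈ (univ : Finset Sg)) =>
    sum_le_sum fun x (_ : x ∈ (univ : Finset X)) => hpoint σ x
  simp only [sum_add_distrib] at htot
  rw [sum_const, card_univ, nsmul_eq_mul] at htot
  have h2 : (∑ σ, ∑ x, if G x ∧ ¬ D σ (p σ x) then K x else 0) ≤ Fintype.card Sg * c := by
    refine (sum_le_sum fun σ _ => hsparse σ).trans ?_
    simp
  have h3 : (∑ σ, ∑ x, K x * if ∃ x', x' ≠ x ∧ A x' ∧ p σ x' = p σ x then (1 : ℝ) else 0)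
      ≤ Fintype.card Sg * δ := by
    rw [sum_comm]
    simp only [← mul_sum]
    refine (sum_le_sum fun x _ => mul_le_mul_of_nonneg_left (hcoll x) (hK.1 x)).trans ?_
    rw [← sum_mul, hK.2, one_mul]
  simp only [← mul_ite_zero, ← mul_sum]
  rw [one_div, ← div_eq_inv_mul, le_div_iff₀ hs]
  linarith

/-- `2^{-i} ≤ 2^{-j} n^{-600}` for `i = j + ⌈600 log₂ n⌉`. -/
theorem two_pow_mul_pow_le_two_pow_add_ceil {n : ℕ} (hn : 1 ≤ n) (j : ℕ) :
    (2 : ℝ) ^ j * (n : ℝ) ^ 600 ≤ 2 ^ (j + ⌈(600 : ℝ) * Real.logb 2 (n : ℝ)⌉₊) := by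
  have hn0 : (0 : ℝ) < n := by exact_mod_cast hn
  rw [pow_add]
  refine mul_le_mul_of_nonneg_left ?_ (by positivity)
  have h := Nat.le_ceil ((600 : ℝ) * Real.logb 2 (n : ℝ))
  calc (n : ℝ) ^ 600 = (2 : ℝ) ^ ((600 : ℝ) * Real.logb 2 (n : ℝ)) := by
        rw [mul_comm, Real.rpow_mul (by norm_num),
          Real.rpow_logb (by norm_num) (by norm_num) hn0]
        exact_mod_cast (Real.rpow_natCast (n : ℝ) 600).symm
    _ ≤ (2 : ℝ) ^ ((⌈(600 : ℝ) * Real.logb 2 (n : ℝ)⌉₊ : ℕ) : ℝ) :=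
        Real.rpow_le_rpow_of_exponent_le (by norm_num) h
    _ = _ := Real.rpow_natCast _ _

/- A family `h : Sg → ({0,1}^n → {0,1}^{3n})` (seed drawn uniformly) is pairwise independent
if for all distinct `x y` and all targets `a b`, `Pr_σ[h σ x = a ∧ h σ y = b] = 2^{-2·3n}`.
For `w : {0,1}^{3n}` and `i ≤ 3n`, the prefix `w_i : {0,1}^i` is `fun t : Fin i => w t`. -/
theorem stmt10 :
    ∃ N : ℕ, ∀ n : ℕ, N ≤ n →
      ∀ (Sg : Type) [Fintype Sg] [Nonempty Sg] [DecidableEq Sg],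
      ∀ h : Sg → (Fin n → ZMod 2) → (Fin (3 * n) → ZMod 2),
        (∀ x y : Fin n → ZMod 2, x ≠ y → ∀ a b : Fin (3 * n) → ZMod 2,
          ((Finset.univ.filter fun σ : Sg => h σ x = a ∧ h σ y = b).card : ℝ)
              / (Fintype.card Sg : ℝ) = 1 / 2 ^ (2 * (3 * n))) →
      ∀ K : (Fin n → ZMod 2) → ℝ, IsDist K →
      ∀ j : ℕ, j ≤ 2 * n - 1 →
        -- `K(G) ≥ 1/(3n)` where `G = {k : 2^{-(j+1)} ≤ K k ≤ 2^{-j}}`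
        (1 / (3 * (n : ℝ)) ≤
          ∑ k, if 1 / 2 ^ (j + 1) ≤ K k ∧ K k ≤ 1 / 2 ^ j then K k else 0) →
      ∀ i : ℕ, i = j + ⌈(600 : ℝ) * Real.logb 2 (n : ℝ)⌉₊ →
      ∀ hi : i ≤ 3 * n,
      ∃ F : Finset (Sg × (Fin i → ZMod 2)),
        -- (1) Pr_{σ ← Σ, k ← K}[(σ, h_σ(k)_i) ∈ F] ≥ 1/(6n) - 1/n^100
        (1 / (6 * (n : ℝ)) - 1 / (n : ℝ) ^ 100 ≤
          ∑ σ : Sg, ∑ k : Fin n → ZMod 2,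
            if (σ, fun t : Fin i => h σ k (Fin.castLE hi t)) ∈ F
            then (1 / (Fintype.card Sg : ℝ)) * K k else 0) ∧
        -- (2) for every (σ, y) ∈ F:
        (∀ σ : Sg, ∀ y : Fin i → ZMod 2, (σ, y) ∈ F →
          -- Pr_{k ← K}[h_σ(k)_i = y] > 0
          (0 < ∑ k : Fin n → ZMod 2,
              if (fun t : Fin i => h σ k (Fin.castLE hi t)) = y then K k else 0) ∧
          -- Pr_{k ← K}[k ∈ G | h_σ(k)_i = y] ≥ 1/(6n)
          (1 / (6 * (n : ℝ)) ≤
            (∑ k : Fin n → ZMod 2,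
                if (1 / 2 ^ (j + 1) ≤ K k ∧ K k ≤ 1 / 2 ^ j)
                    ∧ (fun t : Fin i => h σ k (Fin.castLE hi t)) = y then K k else 0)
              / (∑ k : Fin n → ZMod 2,
                  if (fun t : Fin i => h σ k (Fin.castLE hi t)) = y then K k else 0)) ∧
          -- at most one `k ∈ A = {k : K k ≥ 2^{-j}·n^{-500}}` with `h_σ(k)_i = y`
          (∀ k1 k2 : Fin n → ZMod 2,
            1 / 2 ^ j / (n : ℝ) ^ 500 ≤ K k1 →
            (fun t : Fin i => h σ k1 (Fin.castLE hi t)) = y →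
            1 / 2 ^ j / (n : ℝ) ^ 500 ≤ K k2 →
            (fun t : Fin i => h σ k2 (Fin.castLE hi t)) = y →
            k1 = k2)) := by
  refine ⟨1, ?_⟩
  intro n hn Sg _ _ _ h hh K hK j _ hG i hij hi
  have hn0 : (0 : ℝ) < n := by exact_mod_cast hn
  have hn1 : (1 : ℝ) ≤ n := by exact_mod_cast hn
  have hpow := two_pow_mul_pow_le_two_pow_add_ceil hn j
  rw [← hij] at hpow
  have hδ : ((Finset.univ.filter fun k => 1 / 2 ^ j / (n : ℝ) ^ 500 ≤ K k).card : ℝ) * (1 / 2 ^ i)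
      ≤ 1 / (n : ℝ) ^ 100 := by
    have hA := hK.card_filter_le_mul (1 / 2 ^ j / (n : ℝ) ^ 500) _ fun _ hx => hx
    refine le_trans (mul_le_mul_of_nonneg_left ?_ (Nat.cast_nonneg _))
      ((mul_assoc _ _ (1 / (n : ℝ) ^ 100)).symm.trans_le
        ((mul_le_mul_of_nonneg_right hA (by positivity)).trans_eq (one_mul _)))
    rw [div_div, one_div_mul_one_div, mul_assoc, ← pow_add]
    exact one_div_le_one_div_of_le (by positivity) hpow
  obtain ⟨F, hF1, hF2⟩ := exists_isolating_cells
    (fun σ k => fun t : Fin i => h σ k (Fin.castLE hi t))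
    (fun x y hxy => card_prefix_collision_le hi h x y (hh x y hxy)) hK
    (fun k => 1 / 2 ^ (j + 1) ≤ K k ∧ K k ≤ 1 / 2 ^ j)
    (fun k => 1 / 2 ^ j / (n : ℝ) ^ 500 ≤ K k) (c := 1 / (6 * (n : ℝ))) (by positivity) hδ
    (by positivity)
  refine ⟨F, le_trans ?_ hF1, fun σ y hσ => ?_⟩
  · have : 1 / (3 * (n : ℝ)) = 1 / (6 * (n : ℝ)) + 1 / (6 * (n : ℝ)) := by field_simp; norm_num
    linarith
  · obtain ⟨a, b, d⟩ := hF2 σ y hσ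
    exact ⟨a, b, fun k1 k2 h1 h2 h3 h4 => d k1 k2 h1 h2 h3 h4⟩
end

section
/- Let n ≥ 1, let K be a distribution on a finite set S, let Y be a finite set, f : S → Y a function, y ∈ Y with Pr_{k←K}[f(k) = y] > 0, and let j be an integer. Suppose k* ∈ S satisfies f(k*) = y and K(k*) ≥ 2^{−(j+1)}, and suppose every k' ∈ S with k' ≠ k* and f(k') = y satisfies K(k') ≤ 2^{−j}·n^{−500}. Then for every k' ≠ k*, Pr_{k←K}[ k = k' | f(k) = y ] ≤ 2·n^{−500}. -/
/- `Pr_{k←K}[k = k' | f(k) = y]` is `K({k'} ∩ {f = y}) / K({f = y})`. -/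
theorem stmt13 {S Y : Type*} [Fintype S] [DecidableEq Y]
    (n : ℕ) (hn : 1 ≤ n)
    (K : S → ℝ) (hK : IsDist K) (f : S → Y) (y : Y)
    (hpos : 0 < ∑ k, if f k = y then K k else 0)
    (j : ℤ) (ks : S) (hky : f ks = y) (hkbig : (2 : ℝ) ^ (-(j + 1)) ≤ K ks)
    (hsmall : ∀ k', k' ≠ ks → f k' = y → K k' ≤ (2 : ℝ) ^ (-j) / (n : ℝ) ^ 500) :
    ∀ k', k' ≠ ks →
      (if f k' = y then K k' else 0) / (∑ k, if f k = y then K k else 0)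
        ≤ 2 / (n : ℝ) ^ 500 := by
  intro k' hk'
  by_cases hfk : f k' = y
  · have hks : K ks ≤ ∑ k, if f k = y then K k else 0 := by
      have h := Finset.single_le_sum (f := fun k => if f k = y then K k else 0)
        (fun k _ => ite_nonneg (hK.1 k) le_rfl) (Finset.mem_univ ks)
      simpa [hky] using h
    have hpow : (2 : ℝ) ^ (-j) = 2 * (2 : ℝ) ^ (-(j + 1)) := by
      rw [← zpow_one_add₀ two_ne_zero]
      congr 1
      ring
    rw [if_pos hfk, div_le_iff₀ hpos]
    calc K k' ≤ (2 : ℝ) ^ (-j) / (n : ℝ) ^ 500 := hsmall k' hk' hfk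
      _ = 2 / (n : ℝ) ^ 500 * (2 : ℝ) ^ (-(j + 1)) := by rw [hpow]; ring
      _ ≤ 2 / (n : ℝ) ^ 500 * ∑ k, if f k = y then K k else 0 := by
        gcongr
        exact hkbig.trans hks
  · rw [if_neg hfk, zero_div]
    positivity
end

section
/- Let S be a finite set, X a distribution on S, and let v, t be natural numbers and ε ≥ 0 a real such that there exists a distribution X' on S with SD(X, X') ≤ ε and |supp(X')| ≤ 2^v. Let Y be a finite set with |Y| = 2^{v+t}, let Σ be a finite seed set, and let {f_σ : S → Y}_{σ∈Σ} be any family of functions. Let D be the distribution of the pair (σ, f_σ(x)) with σ ← Σ uniform and x ← X independent, and let D' be the distribution of (σ, u) with σ ← Σ uniform and u ← Y uniform and independent. Then SD(D, D') ≥ 1 − 2^{−t} − ε. -/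
/-- A function of total mass zero has at most half of its `ℓ¹`-norm on any subset. -/
theorem sum_le_half_sum_abs {α : Type*} [Fintype α] (g : α → ℝ) (hg : ∑ a, g a = 0)
    (T : Finset α) : ∑ a ∈ T, g a ≤ (1 / 2) * ∑ a, |g a| := by
  classical
  have h₁ := Finset.sum_add_sum_compl T g
  have h₂ := Finset.sum_add_sum_compl T fun a => |g a|
  have h₃ : ∑ a ∈ T, g a ≤ ∑ a ∈ T, |g a| := Finset.sum_le_sum fun a _ => le_abs_self _
  have h₄ : -∑ a ∈ Tᶜ, g a ≤ ∑ a ∈ Tᶜ, |g a| := by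
    rw [← Finset.sum_neg_distrib]
    exact Finset.sum_le_sum fun a _ => neg_le_abs _
  linarith

/-- A distribution that is `ε`-close to `X'` has mass at least `1 - ε` on the support of `X'`. -/
theorem IsDist.one_sub_le_sum_support {S : Type*} [Fintype S] {X X' : S → ℝ} {ε : ℝ}
    (hX : IsDist X) (hX' : IsDist X') (hε : (1 / 2) * (∑ x, |X x - X' x|) ≤ ε) :
    1 - ε ≤ ∑ x with 0 < X' x, X x := by
  have hmass : ∑ x with 0 < X' x, X' x = 1 := by
    rw [← hX'.2]
    refine Finset.sum_filter_of_ne fun x _ hx => lt_of_le_of_ne (hX'.1 x) hx.symm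
  have h := sum_le_half_sum_abs (fun x => X' x - X x)
    (by rw [Finset.sum_sub_distrib, hX.2, hX'.2, sub_self]) {x | 0 < X' x}
  simp only [Finset.sum_sub_distrib, hmass, abs_sub_comm (X' _)] at h
  linarith

/-- The image under `g` of a distribution with mass at least `m` on `A` is at distance at least
`m - |A| / |Y|` from uniform. -/
theorem IsDist.le_dist_map_uniform {S Y : Type*} [Fintype S] [Fintype Y] [Nonempty Y]
    [DecidableEq Y] {X : S → ℝ} (hX : IsDist X) (g : S → Y) (A : Finset S) {m : ℝ}
    (hm : m ≤ ∑ x ∈ A, X x) :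
    m - (A.card : ℝ) / Fintype.card Y ≤
      (1 / 2) * ∑ y, |(∑ x, if g x = y then X x else 0) - 1 / (Fintype.card Y : ℝ)| := by
  have hY : (Fintype.card Y : ℝ) ≠ 0 := by exact_mod_cast Fintype.card_ne_zero
  have h := sum_le_half_sum_abs
    (fun y => (∑ x, if g x = y then X x else 0) - 1 / (Fintype.card Y : ℝ))
    (by
      rw [Finset.sum_sub_distrib, Finset.sum_comm]
      simp [hX.2, hY]) (A.image g)
  refine le_trans ?_ h
  rw [Finset.sum_sub_distrib, Finset.sum_comm, Finset.sum_const, nsmul_eq_mul, mul_one_div]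
  refine sub_le_sub (hm.trans ?_) ?_
  · simp only [Finset.sum_ite_eq]
    rw [← Finset.sum_filter]
    refine Finset.sum_le_sum_of_subset_of_nonneg (fun x hx => ?_) fun x _ _ => hX.1 x
    simpa using ⟨x, hx, rfl⟩
  · gcongr
    exact Finset.card_image_le

/- `D` is the distribution of `(σ, f_σ(x))` for independent uniform `σ ← Σ` and `x ← X`;
`D'` is the distribution of `(σ, u)` for independent uniform `σ ← Σ` and `u ← Y`.
If `X` is within statistical distance `ε` of a distribution `X'` whose support has size at
most `2^v`, and `|Y| = 2^{v+t}`, then `SD(D, D') ≥ 1 - 2^{-t} - ε`. -/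
theorem stmt15 {S Y Sg : Type*} [Fintype S] [Fintype Y] [Fintype Sg] [Nonempty Sg]
    [DecidableEq Y]
    (X : S → ℝ) (hX : IsDist X)
    (v t : ℕ) (ε : ℝ) (hε : 0 ≤ ε)
    (hX' : ∃ X' : S → ℝ, IsDist X' ∧
      (1 / 2) * (∑ x, |X x - X' x|) ≤ ε ∧
      (Finset.univ.filter fun x => 0 < X' x).card ≤ 2 ^ v)
    (hY : Fintype.card Y = 2 ^ (v + t))
    (f : Sg → S → Y) :
    (1 / 2) * ∑ p : Sg × Y,
        |(1 / (Fintype.card Sg : ℝ)) * (∑ x, if f p.1 x = p.2 then X x else 0)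
            - 1 / ((Fintype.card Sg : ℝ) * (Fintype.card Y : ℝ))|
      ≥ 1 - 1 / 2 ^ t - ε := by
  obtain ⟨X', hdist, hSD, hcard⟩ := hX'
  have : Nonempty Y := Fintype.card_pos_iff.mp (by rw [hY]; positivity)
  have hn : (0 : ℝ) < Fintype.card Sg := by exact_mod_cast Fintype.card_pos
  have hratio : ((Finset.univ.filter fun x => 0 < X' x).card : ℝ) / Fintype.card Y
      ≤ 1 / 2 ^ t := by
    have hc : ((Finset.univ.filter fun x => 0 < X' x).card : ℝ) ≤ 2 ^ v := by exact_mod_cast hcard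
    rw [hY, div_le_div_iff₀ (by positivity) (by positivity)]
    push_cast
    rw [pow_add, one_mul]
    gcongr
  have hseed (σ : Sg) : 1 - 1 / 2 ^ t - ε ≤
      (1 / 2) * ∑ y, |(∑ x, if f σ x = y then X x else 0) - 1 / (Fintype.card Y : ℝ)| := by
    have := hX.le_dist_map_uniform (f σ) _ (hX.one_sub_le_sum_support hdist hSD)
    linarith
  have hterm (σ : Sg) (y : Y) :
      |(1 / (Fintype.card Sg : ℝ)) * (∑ x, if f σ x = y then X x else 0)
        - 1 / ((Fintype.card Sg : ℝ) * (Fintype.card Y : ℝ))|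
      = (1 / (Fintype.card Sg : ℝ)) *
        |(∑ x, if f σ x = y then X x else 0) - 1 / (Fintype.card Y : ℝ)| := by
    rw [← one_div_mul_one_div, ← mul_sub, abs_mul, abs_of_pos (one_div_pos.mpr hn)]
  have hsum := Finset.sum_le_sum fun σ (_ : σ ∈ Finset.univ) => hseed σ
  rw [Finset.sum_const, Finset.card_univ, nsmul_eq_mul, ← Finset.mul_sum] at hsum
  simp only [Fintype.sum_prod_type, hterm, ← Finset.mul_sum]
  rw [ge_iff_le, mul_left_comm, one_div_mul_eq_div, le_div_iff₀ hn, mul_comm]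
  exact hsum
end
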